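/- For every γ ≥ 1 there exist constants 0 < c ≤ C such that for every nondegenerate triangle K ⊂ ℝ² with shape-regularity ratio h_K/ρ_K ≤ γ and every v ∈ N0⁺(K), c ‖v‖²_{L²(K)} ≤ (|K|/3) Σ_{i=1}^{3} |v(m_i)|² ≤ C ‖v‖²_{L²(K)}. That is, the norm induced by the edge-midpoint quadrature is equivalent to the L²(K)-norm on N0⁺(K), with equivalence constants depending only on the shape regularity. -/

import Mathlib

open MeasureTheory

/-- Euclidean scalar product on ℝ². -/
noncomputable def dot (u v : ℝ × ℝ) : ℝ := u.1 * v.1 + u.2 * v.2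

/-- Euclidean diameter of a set in ℝ². -/
noncomputable def ediam (K : Set (ℝ × ℝ)) : ℝ :=
  sSup {d : ℝ | ∃ u ∈ K, ∃ v ∈ K, d = Real.sqrt (dot (u - v) (u - v))}

/-- Euclidean inradius: supremum of radii of (closed Euclidean) balls contained in `K`. -/
noncomputable def einrad (K : Set (ℝ × ℝ)) : ℝ :=
  sSup {r : ℝ | 0 ≤ r ∧ ∃ x : ℝ × ℝ, {y | Real.sqrt (dot (y - x) (y - x)) ≤ r} ⊆ K}

section

open Set

/-- The reference triangle with vertices `(0, 0)`, `(1, 0)`, `(0, 1)`. -/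
def refTriangle : Set (ℝ × ℝ) := {z | 0 ≤ z.1 ∧ 0 ≤ z.2 ∧ z.1 + z.2 ≤ 1}

lemma isClosed_refTriangle : IsClosed refTriangle :=
  (isClosed_le continuous_const continuous_fst).inter
    ((isClosed_le continuous_const continuous_snd).inter
      (isClosed_le (continuous_fst.add continuous_snd) continuous_const))

lemma isCompact_refTriangle : IsCompact refTriangle := by
  refine (isCompact_Icc (a := ((0 : ℝ), (0 : ℝ))) (b := (1, 1))).of_isClosed_subset
    isClosed_refTriangle ?_
  rintro ⟨s, t⟩ ⟨h1, h2, h3⟩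
  simp only at h1 h2 h3
  exact ⟨⟨h1, h2⟩, ⟨by simp only; linarith, by simp only; linarith⟩⟩

lemma Continuous.integrableOn_refTriangle {f : ℝ × ℝ → ℝ} (hf : Continuous f) :
    IntegrableOn f refTriangle :=
  hf.continuousOn.integrableOn_compact isCompact_refTriangle

lemma setIntegral_refTriangle {f : ℝ × ℝ → ℝ} (hf : Continuous f) :
    ∫ z in refTriangle, f z = ∫ s in (0 : ℝ)..1, ∫ t in (0 : ℝ)..(1 - s), f (s, t) := by
  have hm := isClosed_refTriangle.measurableSet
  rw [← integral_indicator hm, Measure.volume_eq_prod,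
    integral_prod _ ((integrable_indicator_iff hm).2 hf.integrableOn_refTriangle),
    intervalIntegral.integral_of_le zero_le_one, ← integral_Icc_eq_integral_Ioc,
    ← integral_indicator measurableSet_Icc]
  congr 1
  ext s
  by_cases hs : s ∈ Icc (0 : ℝ) 1
  · rw [indicator_of_mem hs, intervalIntegral.integral_of_le (by linarith [hs.2]),
      ← integral_Icc_eq_integral_Ioc, ← integral_indicator measurableSet_Icc]
    congr 1
    ext t
    by_cases ht : t ∈ Icc (0 : ℝ) (1 - s)
    · rw [indicator_of_mem ht, indicator_of_mem]
      exact ⟨hs.1, ht.1, by simp only; linarith [ht.2]⟩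
    · rw [indicator_of_notMem ht, indicator_of_notMem]
      rintro ⟨-, h2, h3⟩
      simp only at h2 h3
      exact ht ⟨h2, by linarith⟩
  · rw [indicator_of_notMem hs]
    convert integral_zero ℝ ℝ with t
    rw [indicator_of_notMem]
    rintro ⟨h1, h2, h3⟩
    simp only at h1 h2 h3
    exact hs ⟨h1, by linarith⟩

lemma intervalIntegral_quintic (k₀ k₁ k₂ k₃ k₄ k₅ T : ℝ) :
    ∫ x in (0 : ℝ)..T, (k₀ + k₁ * x + k₂ * x ^ 2 + k₃ * x ^ 3 + k₄ * x ^ 4 + k₅ * x ^ 5) =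
      k₀ * T + k₁ * T ^ 2 / 2 + k₂ * T ^ 3 / 3 + k₃ * T ^ 4 / 4 + k₄ * T ^ 5 / 5
        + k₅ * T ^ 6 / 6 := by
  have h : ∀ x ∈ uIcc 0 T, HasDerivAt (fun x : ℝ ↦ k₀ * x + k₁ * x ^ 2 / 2 + k₂ * x ^ 3 / 3
      + k₃ * x ^ 4 / 4 + k₄ * x ^ 5 / 5 + k₅ * x ^ 6 / 6)
      (k₀ + k₁ * x + k₂ * x ^ 2 + k₃ * x ^ 3 + k₄ * x ^ 4 + k₅ * x ^ 5) x := by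
    intro x _
    have hp (n : ℕ) (m k : ℝ) : HasDerivAt (fun x : ℝ ↦ k * x ^ n / m)
        (k * (n * x ^ (n - 1)) / m) x :=
      ((hasDerivAt_pow n x).const_mul k).div_const _
    refine HasDerivAt.congr_deriv ((((((hasDerivAt_id x).const_mul k₀).add (hp 2 2 k₁)).add
      (hp 3 3 k₂)).add (hp 4 4 k₃)).add (hp 5 5 k₄) |>.add (hp 6 6 k₅)) ?_
    norm_num
    ring
  rw [intervalIntegral.integral_eq_sub_of_hasDerivAt h
    (Continuous.intervalIntegrable (by fun_prop) _ _)]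
  ring

lemma setIntegral_refTriangle_quadratic_sq (c₀ c₁ c₂ c₃ c₄ c₅ : ℝ) :
    ∫ z in refTriangle,
        (c₀ + c₁ * z.1 + c₂ * z.2 + c₃ * (z.1 * z.2) + c₄ * z.1 ^ 2 + c₅ * z.2 ^ 2) ^ 2 =
      c₀ ^ 2 / 2 + c₁ ^ 2 / 12 + c₂ ^ 2 / 12 + c₃ ^ 2 / 180 + c₄ ^ 2 / 30 + c₅ ^ 2 / 30
        + c₀ * c₁ / 3 + c₀ * c₂ / 3 + c₀ * c₃ / 12 + c₀ * c₄ / 6 + c₀ * c₅ / 6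
        + c₁ * c₂ / 12 + c₁ * c₃ / 30 + c₁ * c₄ / 10 + c₁ * c₅ / 30
        + c₂ * c₃ / 30 + c₂ * c₄ / 30 + c₂ * c₅ / 10
        + c₃ * c₄ / 60 + c₃ * c₅ / 60 + c₄ * c₅ / 90 := by
  rw [setIntegral_refTriangle (by fun_prop)]
  have inner (s : ℝ) : ∫ t in (0 : ℝ)..(1 - s),
      (c₀ + c₁ * s + c₂ * t + c₃ * (s * t) + c₄ * s ^ 2 + c₅ * t ^ 2) ^ 2 =
      (c₀ + c₁ * s + c₄ * s ^ 2) ^ 2 * (1 - s)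
        + (c₀ + c₁ * s + c₄ * s ^ 2) * (c₂ + c₃ * s) * (1 - s) ^ 2
        + ((c₂ + c₃ * s) ^ 2 + 2 * (c₀ + c₁ * s + c₄ * s ^ 2) * c₅) * (1 - s) ^ 3 / 3
        + (c₂ + c₃ * s) * c₅ * (1 - s) ^ 4 / 2 + c₅ ^ 2 * (1 - s) ^ 5 / 5 := by
    rw [show (fun t : ℝ ↦ (c₀ + c₁ * s + c₂ * t + c₃ * (s * t) + c₄ * s ^ 2 + c₅ * t ^ 2) ^ 2) =
      fun t ↦ (c₀ + c₁ * s + c₄ * s ^ 2) ^ 2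
        + 2 * (c₀ + c₁ * s + c₄ * s ^ 2) * (c₂ + c₃ * s) * t
        + ((c₂ + c₃ * s) ^ 2 + 2 * (c₀ + c₁ * s + c₄ * s ^ 2) * c₅) * t ^ 2
        + 2 * (c₂ + c₃ * s) * c₅ * t ^ 3 + c₅ ^ 2 * t ^ 4 + 0 * t ^ 5 from by ext t; ring,
      intervalIntegral_quintic]
    ring
  simp only [inner]
  have outer := intervalIntegral_quintic
    (c₀ * c₀ + c₀ * c₂ + (2/3) * (c₀ * c₅) + 1/3 * (c₂ * c₂)
      + 1/2 * (c₂ * c₅) + 1/5 * (c₅ * c₅))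
    ((-1) * (c₀ * c₀) + 2 * (c₀ * c₁) + (-2) * (c₀ * c₂) + c₀ * c₃
      + (-2) * (c₀ * c₅) + c₁ * c₂ + (2/3) * (c₁ * c₅) + (-1) * (c₂ * c₂)
      + (2/3) * (c₂ * c₃) + (-2) * (c₂ * c₅) + 1/2 * (c₃ * c₅) + (-1) * (c₅ * c₅))
    ((-2) * (c₀ * c₁) + c₀ * c₂ + (-2) * (c₀ * c₃) + 2 * (c₀ * c₄)
      + 2 * (c₀ * c₅) + c₁ * c₁ + (-2) * (c₁ * c₂) + c₁ * c₃
      + (-2) * (c₁ * c₅) + c₂ * c₂ + (-2) * (c₂ * c₃) + c₂ * c₄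
      + 3 * (c₂ * c₅) + 1/3 * (c₃ * c₃) + (-2) * (c₃ * c₅) + (2/3) * (c₄ * c₅)
      + 2 * (c₅ * c₅))
    (c₀ * c₃ + (-2) * (c₀ * c₄) + (-2/3) * (c₀ * c₅) + (-1) * (c₁ * c₁)
      + c₁ * c₂ + (-2) * (c₁ * c₃) + 2 * (c₁ * c₄) + 2 * (c₁ * c₅)
      + (-1/3) * (c₂ * c₂) + 2 * (c₂ * c₃) + (-2) * (c₂ * c₄) + (-2) * (c₂ * c₅)
      + (-1) * (c₃ * c₃) + c₃ * c₄ + 3 * (c₃ * c₅) + (-2) * (c₄ * c₅)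
      + (-2) * (c₅ * c₅))
    (c₁ * c₃ + (-2) * (c₁ * c₄) + (-2/3) * (c₁ * c₅) + (-2/3) * (c₂ * c₃)
      + c₂ * c₄ + 1/2 * (c₂ * c₅) + c₃ * c₃ + (-2) * (c₃ * c₄)
      + (-2) * (c₃ * c₅) + c₄ * c₄ + 2 * (c₄ * c₅) + c₅ * c₅)
    ((-1/3) * (c₃ * c₃) + c₃ * c₄ + 1/2 * (c₃ * c₅) + (-1) * (c₄ * c₄)
      + (-2/3) * (c₄ * c₅) + (-1/5) * (c₅ * c₅)) 1
  refine Eq.trans ?_ (outer.trans ?_)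
  · congr 1
    ext s
    ring
  · ring

/-- On the reference triangle, the field with components `P` and `Q` is a general element of the
enriched Nédélec space, written in the basis `∇λ₂, ∇λ₃`. -/
lemma refTriangle_norm_equiv (a e k x y z : ℝ) (P Q : ℝ → ℝ → ℝ)
    (hP : ∀ s t, P s t = a + (z - k) * t - (y + z) * (s * t) - z * t ^ 2)
    (hQ : ∀ s t, Q s t = -e + (k + x) * s - (x + y) * (s * t) - x * s ^ 2) :
    let I := ∫ w in refTriangle, (P w.1 w.2 ^ 2 + Q w.1 w.2 ^ 2)
    let S := ((P (1/2) (1/2) ^ 2 + Q (1/2) (1/2) ^ 2) + (P 0 (1/2) ^ 2 + Q 0 (1/2) ^ 2)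
      + (P (1/2) 0 ^ 2 + Q (1/2) 0 ^ 2)) / 6
    I ≤ 2 * S ∧ S ≤ 4 * I := by
  intro I S
  have hI : I = (a ^ 2 / 2 + (z - k) ^ 2 / 12 + (y + z) ^ 2 / 180 + z ^ 2 / 30
      + a * (z - k) / 3 - a * (y + z) / 12 - a * z / 6 - (z - k) * (y + z) / 30
      - (z - k) * z / 10 + (y + z) * z / 60)
      + (e ^ 2 / 2 + (k + x) ^ 2 / 12 + (x + y) ^ 2 / 180 + x ^ 2 / 30
      - e * (k + x) / 3 + e * (x + y) / 12 + e * x / 6 - (k + x) * (x + y) / 30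
      - (k + x) * x / 10 + (x + y) * x / 60) := by
    simp only [I, hP, hQ]
    rw [integral_add (Continuous.integrableOn_refTriangle (by fun_prop))
      (Continuous.integrableOn_refTriangle (by fun_prop))]
    have h1 := setIntegral_refTriangle_quadratic_sq a 0 (z - k) (-(y + z)) 0 (-z)
    have h2 := setIntegral_refTriangle_quadratic_sq (-e) (k + x) 0 (-(x + y)) (-x) 0
    refine (congrArg₂ (· + ·) (Eq.trans ?_ h1) (Eq.trans ?_ h2)).trans ?_
    · congr 1
      ext w
      ring
    · congr 1
      ext w
      ring
    · ring
  have hS : S = ((P (1/2) (1/2) ^ 2 + Q (1/2) (1/2) ^ 2) + (P 0 (1/2) ^ 2 + Q 0 (1/2) ^ 2)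
      + (P (1/2) 0 ^ 2 + Q (1/2) 0 ^ 2)) / 6 := rfl
  simp only [hP, hQ] at hS
  have h1 : 2 * S - I = 1/2 * (a - 1/3 * k - 1/12 * y + 1/12 * z) ^ 2
      + 1/2 * (e - 1/3 * k - 1/12 * x + 1/12 * y) ^ 2
      + 1/18 * (k + 1/5 * x - 1/5 * z) ^ 2 + 23/2400 * (x + 15/23 * y + 16/69 * z) ^ 2
      + 647/33120 * (y + 159/647 * z) ^ 2 + 689/87345 * z ^ 2 := by
    rw [hS, hI]; ring
  have h2 : 4 * I - S = 3/2 * (a - 1/3 * k - 1/12 * y + 1/12 * z) ^ 2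
      + 3/2 * (e - 1/3 * k - 1/12 * x + 1/12 * y) ^ 2
      + 1/6 * (k + 1/40 * x - 1/40 * z) ^ 2 + 37/28800 * (x - 20/37 * y + 3/37 * z) ^ 2
      + 4/1665 * (y - 17/64 * z) ^ 2 + 17/15360 * z ^ 2 := by
    rw [hS, hI]; ring
  constructor
  · rw [← sub_nonneg, h1]; positivity
  · rw [← sub_nonneg, h2]; positivity

lemma continuous_dot_sub_self : Continuous fun q : (ℝ × ℝ) × (ℝ × ℝ) ↦
    Real.sqrt (dot (q.1 - q.2) (q.1 - q.2)) := by
  unfold dot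
  fun_prop

lemma sqrt_dot_sub_le_ediam {K : Set (ℝ × ℝ)} (hK : IsCompact K) {x y : ℝ × ℝ} (hx : x ∈ K)
    (hy : y ∈ K) : Real.sqrt (dot (x - y) (x - y)) ≤ ediam K := by
  refine le_csSup (((hK.prod hK).image continuous_dot_sub_self).bddAbove.mono ?_) ⟨x, hx, y, hy, rfl⟩
  rintro _ ⟨a, ha, b, hb, rfl⟩
  exact ⟨(a, b), ⟨ha, hb⟩, rfl⟩

lemma dot_self_nonneg (u : ℝ × ℝ) : 0 ≤ dot u u :=
  add_nonneg (mul_self_nonneg _) (mul_self_nonneg _)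

lemma dot_sq_le (u v : ℝ × ℝ) : dot u v ^ 2 ≤ dot u u * dot v v := by
  unfold dot
  nlinarith [sq_nonneg (u.1 * v.2 - u.2 * v.1)]

/-- If an affine function with gradient `u` takes values in `[0, 1]` on `K`, then the inradius of
`K` is at most `1 / |u|`. -/
lemma einrad_le_inv_sqrt {K : Set (ℝ × ℝ)} {u : ℝ × ℝ} {c : ℝ} (hu : 0 < dot u u)
    (h0 : ∀ x ∈ K, 0 ≤ dot u x + c) (h1 : ∀ x ∈ K, dot u x + c ≤ 1) :
    einrad K ≤ 1 / Real.sqrt (dot u u) := by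
  have hq : 0 < Real.sqrt (dot u u) := Real.sqrt_pos.2 hu
  have hqq : Real.sqrt (dot u u) ^ 2 = dot u u := Real.sq_sqrt hu.le
  set q := Real.sqrt (dot u u)
  refine Real.sSup_le ?_ (by positivity)
  rintro r ⟨hr, x, hx⟩
  have hxK : x ∈ K := hx (by simpa [dot] using hr)
  have hyK : x + (r / q) • u ∈ K := by
    refine hx ?_
    have : dot (x + (r / q) • u - x) (x + (r / q) • u - x) = r ^ 2 := by
      have : dot (x + (r / q) • u - x) (x + (r / q) • u - x) = (r / q) ^ 2 * dot u u := by
        simp [dot]; ring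
      rw [this, ← hqq]
      field_simp
    simp only [mem_ofPred_eq, this, Real.sqrt_sq hr, le_refl]
  have hy : dot u (x + (r / q) • u) = dot u x + r * q := by
    have : dot u (x + (r / q) • u) = dot u x + (r / q) * dot u u := by
      simp [dot]; ring
    rw [this, ← hqq]
    field_simp
  rw [le_div_iff₀ hq]
  linarith [h0 x hxK, h1 _ hyK]

/-- The affine parametrization of a triangle by the reference triangle. -/
def triangleMap (p : Fin 3 → ℝ × ℝ) (z : ℝ × ℝ) : ℝ × ℝ :=
  p 0 + z.1 • (p 1 - p 0) + z.2 • (p 2 - p 0)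

lemma dot_triangleMap_sub (p : Fin 3 → ℝ × ℝ) (g z : ℝ × ℝ) :
    dot g (triangleMap p z - p 0) = z.1 * dot g (p 1 - p 0) + z.2 * dot g (p 2 - p 0) := by
  simp [dot, triangleMap]; ring

lemma convexHull_range_eq_image (p : Fin 3 → ℝ × ℝ) :
    convexHull ℝ (range p) = triangleMap p '' refTriangle := by
  apply Subset.antisymm
  · refine convexHull_min ?_ ?_
    · rintro _ ⟨i, rfl⟩
      fin_cases i
      · exact ⟨(0, 0), by simp [refTriangle], by simp [triangleMap]⟩
      · exact ⟨(1, 0), by simp [refTriangle], by simp [triangleMap]⟩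
      · exact ⟨(0, 1), by simp [refTriangle], by simp [triangleMap]⟩
    · rintro _ ⟨y, ⟨hy1, hy2, hy3⟩, rfl⟩ _ ⟨z, ⟨hz1, hz2, hz3⟩, rfl⟩ a b ha hb hab
      refine ⟨a • y + b • z, ⟨?_, ?_, ?_⟩, ?_⟩
      · simp only [Prod.fst_add, Prod.smul_fst, smul_eq_mul]
        positivity
      · simp only [Prod.snd_add, Prod.smul_snd, smul_eq_mul]
        positivity
      · simp only [Prod.fst_add, Prod.smul_fst, Prod.snd_add, Prod.smul_snd, smul_eq_mul]
        nlinarith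
      · obtain rfl : b = 1 - a := by linarith
        simp only [triangleMap, Prod.fst_add, Prod.smul_fst, Prod.snd_add, Prod.smul_snd,
          smul_eq_mul]
        module
  · rintro _ ⟨z, ⟨h1, h2, h3⟩, rfl⟩
    have hc := convex_convexHull ℝ (range p)
    have hp (i : Fin 3) : p i ∈ convexHull ℝ (range p) := subset_convexHull ℝ _ (mem_range_self i)
    have := hc.sum_mem (t := Finset.univ) (w := ![1 - z.1 - z.2, z.1, z.2]) (z := p)
      (by
        intro i _
        fin_cases i
        · simp; linarith
        · simpa using h1
        · simpa using h2)
      (by simp only [Fin.sum_univ_three, Matrix.cons_val]; ring) (fun i _ ↦ hp i)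
    convert this using 1
    simp [triangleMap, Fin.sum_univ_three]
    module

lemma exists_setIntegral_convexHull_eq {p : Fin 3 → ℝ × ℝ}
    (hinj : Function.Injective (triangleMap p)) :
    ∃ D : ℝ, 0 ≤ D ∧ ∀ f : ℝ × ℝ → ℝ,
      ∫ x in convexHull ℝ (range p), f x = D * ∫ z in refTriangle, f (triangleMap p z) := by
  let L : ℝ × ℝ →L[ℝ] ℝ × ℝ := (ContinuousLinearMap.fst ℝ ℝ ℝ).smulRight (p 1 - p 0)
    + (ContinuousLinearMap.snd ℝ ℝ ℝ).smulRight (p 2 - p 0)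
  have hL : ∀ z ∈ refTriangle, HasFDerivWithinAt (triangleMap p) L refTriangle z := by
    intro z _
    have : triangleMap p = fun z ↦ p 0 + L z := by
      ext z <;> simp [triangleMap, L] <;> ring
    rw [this]
    exact (L.hasFDerivWithinAt).const_add _
  refine ⟨|L.det|, abs_nonneg _, fun f ↦ ?_⟩
  rw [convexHull_range_eq_image, integral_image_eq_integral_abs_det_fderiv_smul volume
    isClosed_refTriangle.measurableSet hL hinj.injOn]
  simp only [smul_eq_mul]
  exact integral_const_mul _ _

lemma dot_smul_add_smul (u w : ℝ × ℝ) (ξ η : ℝ) :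
    dot (ξ • u + η • w) (ξ • u + η • w) =
      ξ ^ 2 * dot u u + 2 * (ξ * η) * dot u w + η ^ 2 * dot w w := by
  simp [dot]; ring

/-- The Gram matrix of the gradients `u, w` of two barycentric coordinates of a shape-regular
triangle is comparable with a multiple of the identity. -/
lemma exists_gram_bounds {γ : ℝ} {p : Fin 3 → ℝ × ℝ} {u w : ℝ × ℝ}
    (hγ : 0 ≤ γ)
    (hK : ediam (convexHull ℝ (range p)) ≤ γ * einrad (convexHull ℝ (range p)))
    (hu1 : dot u (p 1 - p 0) = 1) (hu2 : dot u (p 2 - p 0) = 0)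
    (hw1 : dot w (p 1 - p 0) = 0) (hw2 : dot w (p 2 - p 0) = 1) :
    ∃ H : ℝ, 0 < H ∧ ∀ ξ η : ℝ,
      ξ ^ 2 + η ^ 2 ≤ 2 * H * dot (ξ • u + η • w) (ξ • u + η • w) ∧
      H * dot (ξ • u + η • w) (ξ • u + η • w) ≤ 2 * γ ^ 2 * (ξ ^ 2 + η ^ 2) := by
  set K := convexHull ℝ (range p) with hKdef
  have hcomp : IsCompact K := (finite_range p).isCompact_convexHull ℝ
  have hp (i : Fin 3) : p i ∈ K := subset_convexHull ℝ _ (mem_range_self i)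
  have he (i : Fin 3) : dot (p i - p 0) (p i - p 0) ≤ ediam K ^ 2 := by
    have := sqrt_dot_sub_le_ediam hcomp (hp i) (hp 0)
    exact (Real.sqrt_le_left ((Real.sqrt_nonneg _).trans this)).1 this
  have he1 : 0 < dot (p 1 - p 0) (p 1 - p 0) ∧ 0 < dot u u := by
    have h := dot_sq_le u (p 1 - p 0)
    rw [hu1] at h
    constructor <;> refine lt_of_le_of_ne (dot_self_nonneg _) fun h0 ↦ ?_ <;> rw [← h0] at h <;>
      norm_num at h
  have hw0 : 0 < dot w w := by
    have h := dot_sq_le w (p 2 - p 0)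
    rw [hw2] at h
    refine lt_of_le_of_ne (dot_self_nonneg _) fun h0 ↦ ?_
    rw [← h0] at h
    norm_num at h
  have hdiam : 0 < ediam K := by
    refine lt_of_lt_of_le (Real.sqrt_pos.2 he1.1) (sqrt_dot_sub_le_ediam hcomp (hp 1) (hp 0))
  have hgrad (g : ℝ × ℝ) (hg : 0 < dot g g)
      (hb : ∀ z ∈ refTriangle, 0 ≤ dot g (triangleMap p z - p 0) ∧
        dot g (triangleMap p z - p 0) ≤ 1) : ediam K ^ 2 * dot g g ≤ γ ^ 2 := by
    have hr : einrad K ≤ 1 / Real.sqrt (dot g g) := by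
      have hsub (x : ℝ × ℝ) : dot g (x - p 0) = dot g x + -dot g (p 0) := by simp [dot]; ring
      refine einrad_le_inv_sqrt (c := -dot g (p 0)) hg ?_ ?_ <;>
      · rw [hKdef, convexHull_range_eq_image]
        rintro _ ⟨z, hz, rfl⟩
        rw [← hsub]
        first | exact (hb z hz).1 | exact (hb z hz).2
    have hs := Real.sqrt_pos.2 hg
    have h1 : ediam K * Real.sqrt (dot g g) ≤ γ := by
      rw [← le_div_iff₀ hs, div_eq_mul_one_div]
      exact hK.trans (mul_le_mul_of_nonneg_left hr hγ)
    calc ediam K ^ 2 * dot g g = (ediam K * Real.sqrt (dot g g)) ^ 2 := by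
          rw [mul_pow, Real.sq_sqrt hg.le]
      _ ≤ γ ^ 2 := by gcongr
  have hU : ediam K ^ 2 * dot u u ≤ γ ^ 2 := hgrad u he1.2 fun z hz ↦ by
    rw [dot_triangleMap_sub, hu1, hu2]
    constructor <;> linarith [hz.1, hz.2.1, hz.2.2]
  have hW : ediam K ^ 2 * dot w w ≤ γ ^ 2 := hgrad w hw0 fun z hz ↦ by
    rw [dot_triangleMap_sub, hw1, hw2]
    constructor <;> linarith [hz.1, hz.2.1, hz.2.2]
  refine ⟨ediam K ^ 2, by positivity, fun ξ η ↦ ⟨?_, ?_⟩⟩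
  · have hlin (e : ℝ × ℝ) : dot (ξ • u + η • w) e = ξ * dot u e + η * dot w e := by
      simp [dot]; ring
    have h1 := dot_sq_le (ξ • u + η • w) (p 1 - p 0)
    have h2 := dot_sq_le (ξ • u + η • w) (p 2 - p 0)
    rw [hlin, hu1, hw1] at h1
    rw [hlin, hu2, hw2] at h2
    have hN := dot_self_nonneg (ξ • u + η • w)
    have h3 := mul_le_mul_of_nonneg_left (he 1) hN
    have h4 := mul_le_mul_of_nonneg_left (he 2) hN
    linarith
  · have hpar : dot (ξ • u + η • w) (ξ • u + η • w) ≤ 2 * (ξ ^ 2 * dot u u + η ^ 2 * dot w w) := by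
      have h := dot_self_nonneg (ξ • u + (-η) • w)
      rw [dot_smul_add_smul] at h ⊢
      linarith
    calc _ ≤ ediam K ^ 2 * (2 * (ξ ^ 2 * dot u u + η ^ 2 * dot w w)) := by gcongr
      _ = 2 * (ξ ^ 2 * (ediam K ^ 2 * dot u u) + η ^ 2 * (ediam K ^ 2 * dot w w)) := by ring
      _ ≤ 2 * (ξ ^ 2 * γ ^ 2 + η ^ 2 * γ ^ 2) := by gcongr
      _ = _ := by ring

lemma eq_zero_of_dot_eq_zero {u w e f G : ℝ × ℝ} (hue : dot u e = 1) (huf : dot u f = 0)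
    (hwf : dot w f = 1) (he : dot G e = 0) (hf : dot G f = 0) : G = 0 := by
  unfold dot at *
  have hdet : (u.1 * w.2 - u.2 * w.1) * (e.1 * f.2 - e.2 * f.1) = 1 := by
    linear_combination (w.1 * f.1 + w.2 * f.2) * hue + hwf - (w.1 * e.1 + w.2 * e.2) * huf
  ext
  · change G.1 = 0
    linear_combination (-G.1) * hdet + (u.1 * w.2 - u.2 * w.1) * (f.2 * he - e.2 * hf)
  · change G.2 = 0
    linear_combination (-G.2) * hdet + (u.1 * w.2 - u.2 * w.1) * (e.1 * hf - f.1 * he)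

end

/-- For every `γ ≥ 1` there exist `0 < c ≤ C` such that for every
nondegenerate triangle `K ⊂ ℝ²` with `h_K/ρ_K ≤ γ` and every `v ∈ N0⁺(K)`:
`c ‖v‖²_{L²(K)} ≤ (|K|/3) Σᵢ |v(mᵢ)|² ≤ C ‖v‖²_{L²(K)}`. -/
theorem stmt_4 :
    ∀ γ : ℝ, 1 ≤ γ →
      ∃ c C : ℝ, 0 < c ∧ c ≤ C ∧
        ∀ (p : Fin 3 → ℝ × ℝ), AffineIndependent ℝ p →
        ∀ (K : Set (ℝ × ℝ)), K = convexHull ℝ (Set.range p) →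
        ∀ (m : Fin 3 → ℝ × ℝ), (∀ i : Fin 3, m i = midpoint ℝ (p (i + 1)) (p (i + 2))) →
        ediam K ≤ γ * einrad K →
        ∀ (lam : Fin 3 → ℝ × ℝ → ℝ) (g : Fin 3 → ℝ × ℝ) (cc : Fin 3 → ℝ),
          (∀ i x, lam i x = dot (g i) x + cc i) →
          (∀ i j, lam i (p j) = if i = j then 1 else 0) →
        ∀ (Phi0 PhiB : Fin 3 → ℝ × ℝ → ℝ × ℝ),
          (∀ i x, Phi0 i x = lam i x • g (i + 1) - lam (i + 1) x • g i) →
          (∀ i x, PhiB i x = (lam i x * lam (i + 1) x) • g (i + 2)) →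
        ∀ (v : ℝ × ℝ → ℝ × ℝ) (av bv : Fin 3 → ℝ),
          (∀ x, v x = ∑ i : Fin 3, (av i • Phi0 i x + bv i • PhiB i x)) →
        c * (∫ x in K, dot (v x) (v x))
            ≤ ((volume K).toReal / 3) * ∑ i : Fin 3, dot (v (m i)) (v (m i)) ∧
        ((volume K).toReal / 3) * ∑ i : Fin 3, dot (v (m i)) (v (m i))
            ≤ C * (∫ x in K, dot (v x) (v x)) := by

  intro γ hγ
  refine ⟨1 / (8 * γ ^ 2), 16 * γ ^ 2, by positivity, ?_, ?_⟩
  · rw [div_le_iff₀ (by positivity)]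
    nlinarith [one_le_pow₀ hγ (n := 4)]
  intro p _ K hK m hm hreg lam g cc hlam hδ Phi0 PhiB hPhi0 hPhiB v av bv hv
  subst hK
  have hdual (i j : Fin 3) : dot (g i) (p j - p 0) = lam i (p j) - lam i (p 0) := by
    simp only [hlam, dot, Prod.fst_sub, Prod.snd_sub]
    ring
  have hu1 : dot (g 1) (p 1 - p 0) = 1 := by simp [hdual, hδ]
  have hu2 : dot (g 1) (p 2 - p 0) = 0 := by simp [hdual, hδ]
  have hw1 : dot (g 2) (p 1 - p 0) = 0 := by simp [hdual, hδ]
  have hw2 : dot (g 2) (p 2 - p 0) = 1 := by simp [hdual, hδ]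
  have hG : g 0 = -(g 1 + g 2) := by
    have hadd (e : ℝ × ℝ) : dot (g 0 + (g 1 + g 2)) e =
        dot (g 0) e + (dot (g 1) e + dot (g 2) e) := by
      simp only [dot, Prod.fst_add, Prod.snd_add]
      ring
    refine eq_neg_of_add_eq_zero_left (eq_zero_of_dot_eq_zero hu1 hu2 hw2 ?_ ?_)
    · rw [hadd, hu1, hw1]; simp [hdual, hδ]
    · rw [hadd, hu2, hw2]; simp [hdual, hδ]
  have hlam_map (i : Fin 3) (z : ℝ × ℝ) : lam i (triangleMap p z) =
      lam i (p 0) + z.1 * (lam i (p 1) - lam i (p 0)) + z.2 * (lam i (p 2) - lam i (p 0)) := by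
    have h := dot_triangleMap_sub p (g i) z
    rw [hdual, hdual] at h
    rw [add_assoc, ← h, hlam, hlam]
    simp only [dot, Prod.fst_sub, Prod.snd_sub]
    ring
  have hl0 (z : ℝ × ℝ) : lam 0 (triangleMap p z) = 1 - z.1 - z.2 := by
    rw [hlam_map]; simp [hδ]; ring
  have hl1 (z : ℝ × ℝ) : lam 1 (triangleMap p z) = z.1 := by
    rw [hlam_map]; simp [hδ]
  have hl2 (z : ℝ × ℝ) : lam 2 (triangleMap p z) = z.2 := by
    rw [hlam_map]; simp [hδ]
  have hinj : Function.Injective (triangleMap p) := fun y z h ↦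
    Prod.ext (by rw [← hl1, ← hl1, h]) (by rw [← hl2, ← hl2, h])
  let P (s t : ℝ) : ℝ := av 0 + (bv 2 - (av 0 + av 1 + av 2)) * t - (bv 1 + bv 2) * (s * t)
    - bv 2 * t ^ 2
  let Q (s t : ℝ) : ℝ := -av 2 + (av 0 + av 1 + av 2 + bv 0) * s - (bv 0 + bv 1) * (s * t)
    - bv 0 * s ^ 2
  have hvmap (z : ℝ × ℝ) : v (triangleMap p z) = P z.1 z.2 • g 1 + Q z.1 z.2 • g 2 := by
    have e12 : (1 : Fin 3) + 1 = 2 := rfl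
    have e20 : (2 : Fin 3) + 1 = 0 := rfl
    have e10 : (1 : Fin 3) + 2 = 0 := rfl
    have e21 : (2 : Fin 3) + 2 = 1 := rfl
    simp only [hv, hPhi0, hPhiB, Fin.sum_univ_three, zero_add, e12, e20, e10, e21, hl0, hl1, hl2,
      hG, P, Q]
    module
  have hm0 : m 0 = triangleMap p (1 / 2, 1 / 2) := by
    rw [hm, midpoint_eq_smul_add, triangleMap]
    simp only [zero_add, invOf_eq_inv]
    module
  have hm1 : m 1 = triangleMap p (0, 1 / 2) := by
    rw [hm, midpoint_eq_smul_add, triangleMap, show (1 : Fin 3) + 1 = 2 from rfl,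
      show (1 : Fin 3) + 2 = 0 from rfl]
    simp only [invOf_eq_inv]
    module
  have hm2 : m 2 = triangleMap p (1 / 2, 0) := by
    rw [hm, midpoint_eq_smul_add, triangleMap, show (2 : Fin 3) + 1 = 0 from rfl,
      show (2 : Fin 3) + 2 = 1 from rfl]
    simp only [invOf_eq_inv]
    module
  obtain ⟨D, hD, hcov⟩ := exists_setIntegral_convexHull_eq hinj
  have hvol : (volume (convexHull ℝ (Set.range p))).toReal = D / 2 := by
    have h1 := setIntegral_refTriangle_quadratic_sq 1 0 0 0 0 0
    norm_num at h1
    have h := hcov fun _ ↦ 1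
    simp only [setIntegral_one_eq_measureReal] at h
    rw [← measureReal_def, h, h1]
    ring
  obtain ⟨H, hH, hgram⟩ := exists_gram_bounds (by linarith) hreg hu1 hu2 hw1 hw2
  obtain ⟨hIS, hSI⟩ := refTriangle_norm_equiv (av 0) (av 2) (av 0 + av 1 + av 2) (bv 0) (bv 1)
    (bv 2) P Q (fun _ _ ↦ rfl) (fun _ _ ↦ rfl)
  let N (s t : ℝ) : ℝ := dot (P s t • g 1 + Q s t • g 2) (P s t • g 1 + Q s t • g 2)
  have hNc : Continuous fun z : ℝ × ℝ ↦ N z.1 z.2 := by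
    simp only [N, P, Q, dot_smul_add_smul]
    fun_prop
  have hPQc : Continuous fun z : ℝ × ℝ ↦ P z.1 z.2 ^ 2 + Q z.1 z.2 ^ 2 := by
    simp only [P, Q]
    fun_prop
  have hN1 (s t : ℝ) : P s t ^ 2 + Q s t ^ 2 ≤ 2 * H * N s t := (hgram _ _).1
  have hN2 (s t : ℝ) : H * N s t ≤ 2 * γ ^ 2 * (P s t ^ 2 + Q s t ^ 2) := (hgram _ _).2
  have hI1 : ∫ z in refTriangle, (P z.1 z.2 ^ 2 + Q z.1 z.2 ^ 2) ≤
      2 * H * ∫ z in refTriangle, N z.1 z.2 := by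
    rw [← integral_const_mul]
    exact setIntegral_mono_on hPQc.integrableOn_refTriangle
      (hNc.const_mul _).integrableOn_refTriangle isClosed_refTriangle.measurableSet
      fun z _ ↦ hN1 _ _
  have hI2 : H * ∫ z in refTriangle, N z.1 z.2 ≤
      2 * γ ^ 2 * ∫ z in refTriangle, (P z.1 z.2 ^ 2 + Q z.1 z.2 ^ 2) := by
    rw [← integral_const_mul, ← integral_const_mul]
    exact setIntegral_mono_on (hNc.const_mul _).integrableOn_refTriangle
      (hPQc.const_mul _).integrableOn_refTriangle isClosed_refTriangle.measurableSet
      fun z _ ↦ hN2 _ _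
  rw [hvol, hcov, Fin.sum_univ_three, hm0, hm1, hm2]
  simp only [hvmap]
  change 1 / (8 * γ ^ 2) * (D * ∫ z in refTriangle, N z.1 z.2) ≤
      D / 2 / 3 * (N (1 / 2) (1 / 2) + N 0 (1 / 2) + N (1 / 2) 0) ∧
    D / 2 / 3 * (N (1 / 2) (1 / 2) + N 0 (1 / 2) + N (1 / 2) 0) ≤
      16 * γ ^ 2 * (D * ∫ z in refTriangle, N z.1 z.2)
  have hS1 : (P (1/2) (1/2) ^ 2 + Q (1/2) (1/2) ^ 2) + (P 0 (1/2) ^ 2 + Q 0 (1/2) ^ 2)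
      + (P (1/2) 0 ^ 2 + Q (1/2) 0 ^ 2) ≤
      2 * H * (N (1 / 2) (1 / 2) + N 0 (1 / 2) + N (1 / 2) 0) := by
    linarith [hN1 (1 / 2) (1 / 2), hN1 0 (1 / 2), hN1 (1 / 2) 0]
  have hS2 : H * (N (1 / 2) (1 / 2) + N 0 (1 / 2) + N (1 / 2) 0) ≤ 2 * γ ^ 2 *
      ((P (1/2) (1/2) ^ 2 + Q (1/2) (1/2) ^ 2) + (P 0 (1/2) ^ 2 + Q 0 (1/2) ^ 2)
      + (P (1/2) 0 ^ 2 + Q (1/2) 0 ^ 2)) := by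
    linarith [hN2 (1 / 2) (1 / 2), hN2 0 (1 / 2), hN2 (1 / 2) 0]
  generalize (∫ z in refTriangle, N z.1 z.2) = IN at *
  generalize (∫ z in refTriangle, (P z.1 z.2 ^ 2 + Q z.1 z.2 ^ 2)) = I at *
  generalize N (1 / 2) (1 / 2) + N 0 (1 / 2) + N (1 / 2) 0 = SN at *
  generalize (P (1/2) (1/2) ^ 2 + Q (1/2) (1/2) ^ 2) + (P 0 (1/2) ^ 2 + Q 0 (1/2) ^ 2)
      + (P (1/2) 0 ^ 2 + Q (1/2) 0 ^ 2) = S at *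
  have hγ2 : 0 ≤ 2 * γ ^ 2 := by positivity
  constructor
  · have key : IN ≤ 8 * γ ^ 2 * (SN / 6) := by
      refine le_of_mul_le_mul_left ?_ hH
      have h1 := mul_le_mul_of_nonneg_left hIS hγ2
      have h2 := mul_le_mul_of_nonneg_left hS1 hγ2
      linarith
    rw [one_div, inv_mul_le_iff₀ (by positivity)]
    linarith [mul_le_mul_of_nonneg_left key hD]
  · have key : SN / 6 ≤ 16 * γ ^ 2 * IN := by
      refine le_of_mul_le_mul_left ?_ hH
      have h1 := mul_le_mul_of_nonneg_left hSI hγ2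
      have h2 := mul_le_mul_of_nonneg_left hI1 hγ2
      linarith
    linarith [mul_le_mul_of_nonneg_left key hD]
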